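/- arXiv:2304.02165 — 6 statements merged into one kernel-verified Lean document; each statement's English description precedes it below -/
import Mathlib

section
/- Let R be a field, x an indeterminate over R, and let ℓ ∈ R[x] have degree 1. Then a polynomial f ∈ R[x] is a logical power of ℓ (i.e., ℓ divides f, ℓ − 1 divides f − 1, and every divisor of f is a unit or a multiple of ℓ) if and only if f = ℓ^n for some integer n ≥ 1. -/
open Polynomial

/-- Over a field `R`, if `ℓ ∈ R[x]` has degree `1`, then `f` is a logical power of `ℓ`
(`ℓ ∣ f`, `ℓ - 1 ∣ f - 1`, and every divisor of `f` is a unit or a multiple of `ℓ`)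
if and only if `f = ℓ^n` for some `n ≥ 1`. -/
theorem stmt_2 {R : Type*} [Field R] (ℓ : R[X]) (hℓ : ℓ.degree = 1) (f : R[X]) :
    (ℓ ∣ f ∧ (ℓ - 1) ∣ (f - 1) ∧ ∀ g : R[X], g ∣ f → IsUnit g ∨ ℓ ∣ g) ↔
      ∃ n : ℕ, 1 ≤ n ∧ f = ℓ ^ n := by
  have hirr : Irreducible ℓ := irreducible_of_degree_eq_one hℓ
  constructor
  · rintro ⟨hdvd, hsub, hdiv⟩
    have hdeg : (ℓ - 1).degree = 1 := by
      rw [← C_1, degree_sub_C (by rw [hℓ]; exact zero_lt_one), hℓ]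
    have hnu : ¬ IsUnit (ℓ - 1) := (irreducible_of_degree_eq_one hdeg).not_isUnit
    have hf : f ≠ 0 := by
      rintro rfl
      exact hnu (isUnit_of_dvd_one (by simpa using hsub))
    obtain ⟨n, g, hg, rfl⟩ := WfDvdMonoid.max_power_factor hf hirr
    have hgu : IsUnit g := (hdiv g (dvd_mul_left _ _)).resolve_right hg
    obtain ⟨c, -, rfl⟩ := isUnit_iff.mp hgu
    have hpow : ℓ - 1 ∣ ℓ ^ n - 1 := by simpa using sub_dvd_pow_sub_pow ℓ 1 n
    have hc : ℓ - 1 ∣ C (c - 1) := by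
      have h := dvd_sub hsub (hpow.mul_right (C c))
      rwa [show ℓ ^ n * C c - 1 - (ℓ ^ n - 1) * C c = C (c - 1) by
        rw [C_sub, C_1]; ring] at h
    have hc1 : c = 1 := by
      by_contra h
      exact hnu (isUnit_of_dvd_unit hc (isUnit_C.mpr (sub_ne_zero.mpr h).isUnit))
    subst hc1
    refine ⟨n, Nat.one_le_iff_ne_zero.mpr ?_, by simp⟩
    rintro rfl
    exact hirr.not_isUnit (isUnit_of_dvd_one (by simpa using hdvd))
  · rintro ⟨n, hn, rfl⟩
    refine ⟨dvd_pow_self ℓ (by lia), by simpa using sub_dvd_pow_sub_pow ℓ 1 n, fun g hg => ?_⟩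
    obtain ⟨i, -, hi⟩ := (dvd_prime_pow hirr.prime n).mp hg
    rcases Nat.eq_zero_or_pos i with rfl | hpos
    · left
      rwa [pow_zero, associated_one_iff_isUnit] at hi
    · exact .inr ((dvd_pow_self ℓ hpos.ne').trans hi.symm.dvd)
end

section
/- Let S be a commutative unital ring of characteristic c > 0, and let ℓ ∈ S be such that: (i) ℓ − 1 is regular; (ii) for all positive integers m and n, ℓ^m − 1 divides ℓ^n − 1 if and only if m divides n; (iii) for every integer n, if ℓ − 1 divides n·1_S then n·1_S = 0. Then for every y ∈ S: there exists a positive integer n divisible by c with y = ℓ^n, if and only if there exists a positive integer n with y = ℓ^n and (ℓ − 1)^2 divides y − 1. -/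
/-- A power of `x` agrees with its first-order expansion at `1` modulo `(x - 1) ^ 2`. -/
theorem sub_one_sq_dvd_pow_sub_one_sub {R : Type*} [CommRing R] (x : R) (n : ℕ) :
    (x - 1) ^ 2 ∣ x ^ n - 1 - (x - 1) * n := by
  induction n with
  | zero => simp
  | succ n ih =>
    obtain ⟨k, hk⟩ := ih
    refine ⟨k * x + n, ?_⟩
    push_cast
    linear_combination x * hk


/-- Let `S` be a commutative unital ring of characteristic `c > 0` and `ℓ ∈ S` with:
`ℓ - 1` regular; `ℓ^m - 1 ∣ ℓ^n - 1 ↔ m ∣ n` for positive `m, n`; and `0` is the only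
multiple of `ℓ - 1` among the integer multiples of `1`. Then `y` is a power of `ℓ` whose
exponent is a positive multiple of `c` iff `y` is a positive power of `ℓ` and
`(ℓ - 1)^2 ∣ y - 1`. -/
theorem stmt_3 {S : Type*} [CommRing S] (c : ℕ) (hc : 0 < c) [CharP S c] (ℓ : S)
    (hreg : ∀ b c' : S, (ℓ - 1) * b = (ℓ - 1) * c' → b = c')
    (hdvd : ∀ m n : ℕ, 0 < m → 0 < n → ((ℓ ^ m - 1) ∣ (ℓ ^ n - 1) ↔ m ∣ n))
    (hZ : ∀ n : ℤ, (ℓ - 1) ∣ (n : S) → (n : S) = 0) :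
    ∀ y : S,
      (∃ n : ℕ, 0 < n ∧ c ∣ n ∧ y = ℓ ^ n) ↔
        (∃ n : ℕ, 0 < n ∧ y = ℓ ^ n ∧ (ℓ - 1) ^ 2 ∣ (y - 1)) := by
  have key (n : ℕ) : (ℓ - 1) ^ 2 ∣ ℓ ^ n - 1 ↔ c ∣ n := by
    rw [dvd_iff_dvd_of_dvd_sub (sub_one_sq_dvd_pow_sub_one_sub ℓ n), ← CharP.cast_eq_zero_iff S c n]
    refine ⟨?_, fun h => by simp [h]⟩
    rintro ⟨k, hk⟩
    have hn : (n : S) = (ℓ - 1) * k := hreg _ _ (by rw [hk]; ring)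
    exact_mod_cast hZ n ⟨k, by exact_mod_cast hn⟩
  intro y
  constructor
  · rintro ⟨n, hn, hcn, rfl⟩
    exact ⟨n, hn, rfl, (key n).2 hcn⟩
  · rintro ⟨n, hn, rfl, hd⟩
    exact ⟨n, hn, (key n).1 hd, rfl⟩
end

section
/- Let S be a commutative unital ring whose characteristic is a prime number p, and let ℓ ∈ S be such that: (i) ℓ − 1 is regular; (ii) for all positive integers m and n, ℓ^m − 1 divides ℓ^n − 1 if and only if m divides n; (iii) for every integer n, if ℓ − 1 divides n·1_S then n·1_S = 0. Then for every y ∈ S, the following are equivalent: (a) y = ℓ^(p^k) for some integer k ≥ 1; (b) y = ℓ^n for some positive multiple n of p, and for every y' of the form y' = ℓ^m with m ≥ 1 such that y' ≠ ℓ and y' − 1 divides y − 1, there is a positive multiple n' of p with y' = ℓ^(n'). -/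
/-- If `ℓ ^ m - 1 ∣ ℓ ^ n - 1` forces `m ∣ n`, then the positive powers of `ℓ` are distinct. -/
theorem eq_of_pow_eq_pow_of_dvd_iff {S : Type*} [CommRing S] {ℓ : S}
    (hdvd : ∀ m n : ℕ, 0 < m → 0 < n → ((ℓ ^ m - 1) ∣ (ℓ ^ n - 1) ↔ m ∣ n))
    {m n : ℕ} (hm : 0 < m) (hn : 0 < n) (h : ℓ ^ m = ℓ ^ n) : m = n :=
  Nat.dvd_antisymm ((hdvd m n hm hn).1 (by rw [h])) ((hdvd n m hn hm).1 (by rw [h]))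


/-- Let `S` be a commutative unital ring of prime characteristic `p` and `ℓ ∈ S` with:
`ℓ - 1` regular; `ℓ^m - 1 ∣ ℓ^n - 1 ↔ m ∣ n` for positive `m, n`; and `0` is the only
multiple of `ℓ - 1` among the integer multiples of `1`.  Then `y = ℓ^(p^k)` for some
`k ≥ 1` iff `y` is a power of `ℓ` with exponent a positive multiple of `p`, and every
`y' = ℓ^m` (`m ≥ 1`) with `y' ≠ ℓ` and `y' - 1 ∣ y - 1` is a power of `ℓ` with exponent
a positive multiple of `p`. -/
theorem stmt_4 {S : Type*} [CommRing S] (p : ℕ) (hp : p.Prime) [CharP S p] (ℓ : S)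
    (hreg : ∀ b c : S, (ℓ - 1) * b = (ℓ - 1) * c → b = c)
    (hdvd : ∀ m n : ℕ, 0 < m → 0 < n → ((ℓ ^ m - 1) ∣ (ℓ ^ n - 1) ↔ m ∣ n))
    (hZ : ∀ n : ℤ, (ℓ - 1) ∣ (n : S) → (n : S) = 0) :
    ∀ y : S,
      (∃ k : ℕ, 1 ≤ k ∧ y = ℓ ^ (p ^ k)) ↔
        ((∃ n : ℕ, 0 < n ∧ p ∣ n ∧ y = ℓ ^ n) ∧
          ∀ y' : S, ∀ m : ℕ, 1 ≤ m → y' = ℓ ^ m → y' ≠ ℓ → (y' - 1) ∣ (y - 1) →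
            ∃ n' : ℕ, 0 < n' ∧ p ∣ n' ∧ y' = ℓ ^ n') := by
  intro y
  constructor
  · rintro ⟨k, hk, rfl⟩
    refine ⟨⟨p ^ k, pow_pos hp.pos k, dvd_pow_self p (by omega), rfl⟩, ?_⟩
    rintro y' m hm rfl hne hd
    obtain ⟨j, -, rfl⟩ := (Nat.dvd_prime_pow hp).1 ((hdvd m _ hm (pow_pos hp.pos k)).1 hd)
    refine ⟨p ^ j, hm, dvd_pow_self p ?_, rfl⟩
    rintro rfl
    simp at hne
  · rintro ⟨⟨n, hn, hpn, rfl⟩, h⟩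
    have hn_pow : n = p ^ n.primeFactorsList.length := by
      refine Nat.eq_prime_pow_of_unique_prime_dvd hn.ne' fun {q} hq hqn => ?_
      have hne : ℓ ^ q ≠ ℓ := fun e =>
        hq.ne_one (eq_of_pow_eq_pow_of_dvd_iff hdvd hq.pos one_pos (by rw [e, pow_one]))
      obtain ⟨n', hn', hpn', e⟩ := h _ q hq.one_lt.le rfl hne ((hdvd q n hq.pos hn).2 hqn)
      rw [← eq_of_pow_eq_pow_of_dvd_iff hdvd hq.pos hn' e] at hpn'
      exact ((Nat.prime_dvd_prime_iff_eq hp hq).1 hpn').symm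
    refine ⟨n.primeFactorsList.length, Nat.one_le_iff_ne_zero.2 fun h0 => ?_, by rw [← hn_pow]⟩
    rw [h0, pow_zero] at hn_pow
    exact hp.one_lt.ne' (Nat.dvd_one.1 (hn_pow ▸ hpn))
end

section
/- Let R be a field, x an indeterminate over R, and let ℓ, ℓ' ∈ R[x] have degree 1, written as ℓ' = r·ℓ − s with r ∈ R, r ≠ 0, and s ∈ R. Then ℓ' and ℓ are 1-connected (i.e., for all positive integers m, n, if ℓ − ℓ' divides ℓ^m − (ℓ')^n then m = n) if and only if exactly one of the following holds: (a) r = 1 and s = 0; or (b) r ≠ 1, s ≠ 0, and the element s/(r − 1) of R has infinite multiplicative order (i.e., (s/(r−1))^n ≠ 1 for every integer n ≥ 1). -/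
open Polynomial

theorem Polynomial.exists_eval_eq_of_degree_eq_one {R : Type*} [Field R] {p : R[X]}
    (hp : p.degree = 1) (t : R) : ∃ x, p.eval x = t := by
  have h : (p - C t).degree = 1 := by
    rw [degree_sub_C (by rw [hp]; exact one_pos), hp]
  obtain ⟨x, hx⟩ := exists_root_of_degree_eq_one h
  exact ⟨x, by simpa [sub_eq_zero] using hx⟩

/-- When `r ≠ 1`, both `p` and `C r * p - C s` are congruent to the constant `s / (r - 1)`
modulo their difference. -/
theorem Polynomial.sub_dvd_pow_sub_pow_iff_of_affine {R : Type*} [Field R] {p q : R[X]}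
    (hp : p.degree = 1) {r s : R} (hr : r ≠ 1) (hq : q = C r * p - C s) (m n : ℕ) :
    p - q ∣ p ^ m - q ^ n ↔ (s / (r - 1)) ^ m = (s / (r - 1)) ^ n := by
  have hr' : r - 1 ≠ 0 := sub_ne_zero.mpr hr
  set t := s / (r - 1) with ht
  have hs : s = (r - 1) * t := by rw [ht]; field_simp
  have hsub : p - q = C (1 - r) * (p - C t) := by
    rw [hq, hs]; simp only [C_mul, C_sub, C_1]; ring
  have hqt : q - C t = C r * (p - C t) := by
    rw [hq, hs]; simp only [C_mul, C_sub, C_1]; ring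
  constructor
  · intro h
    obtain ⟨x, hx⟩ := exists_eval_eq_of_degree_eq_one hp t
    have hqx : q.eval x = t := by
      have := congrArg (eval x) hqt
      simpa [hx, sub_eq_zero] using this
    have := eval_dvd (x := x) h
    simpa [hx, hqx, sub_eq_zero] using this
  · intro h
    have hunit : IsUnit (C (1 - r)) :=
      isUnit_C.mpr (sub_ne_zero.mpr hr.symm).isUnit
    rw [hsub, hunit.mul_left_dvd]
    have h₁ : p - C t ∣ p ^ m - C t ^ m := sub_dvd_pow_sub_pow _ _ _
    have h₂ : p - C t ∣ q ^ n - C t ^ n :=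
      (Dvd.intro_left _ hqt.symm).trans (sub_dvd_pow_sub_pow _ _ _)
    have h₃ : C t ^ m = C t ^ n := by rw [← C_pow, ← C_pow, h]
    rw [h₃] at h₁
    simpa using dvd_sub h₁ h₂

/-- Over a field `R`, let `ℓ, ℓ' ∈ R[x]` have degree one, with `ℓ' = r·ℓ - s`, `r ≠ 0`.
Then `ℓ'` and `ℓ` are 1-connected (for all positive `m, n`, `ℓ - ℓ' ∣ ℓ^m - ℓ'^n` implies
`m = n`) iff either `r = 1` and `s = 0`, or `r ≠ 1`, `s ≠ 0`, and `s/(r-1)` has infinite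
multiplicative order. -/
theorem stmt_10 {R : Type*} [Field R] (ℓ ℓ' : R[X]) (hℓ : ℓ.degree = 1)
    (hℓ' : ℓ'.degree = 1) (r s : R) (hr : r ≠ 0) (heq : ℓ' = C r * ℓ - C s) :
    (∀ m n : ℕ, 0 < m → 0 < n → (ℓ - ℓ') ∣ (ℓ ^ m - ℓ' ^ n) → m = n) ↔
      ((r = 1 ∧ s = 0) ∨
        (r ≠ 1 ∧ s ≠ 0 ∧ ∀ n : ℕ, 1 ≤ n → (s / (r - 1)) ^ n ≠ 1)) := by
  by_cases hr1 : r = 1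
  · subst hr1
    by_cases hs : s = 0
    · subst hs
      have hpow : ∀ m n : ℕ, ℓ ^ m = ℓ ^ n → m = n := fun m n h => by
        have := congrArg natDegree h
        simpa [natDegree_pow, natDegree_eq_of_degree_eq_some hℓ] using this
      simp only [C_1, one_mul, C_0, sub_zero] at heq
      subst heq
      simpa [sub_eq_zero] using fun m n _ _ h => hpow m n h
    · have hunit : IsUnit (ℓ - ℓ') := by
        have : ℓ - ℓ' = C s := by rw [heq]; simp
        rw [this]
        exact isUnit_C.mpr (Ne.isUnit hs)
      refine ⟨fun h => ?_, by simp [hs]⟩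
      exact absurd (h 1 2 one_pos two_pos hunit.dvd) (by decide)
  · simp only [sub_dvd_pow_sub_pow_iff_of_affine hℓ hr1 heq]
    have hr' : r - 1 ≠ 0 := sub_ne_zero.mpr hr1
    constructor
    · refine fun h => Or.inr ⟨hr1, fun hs => ?_, fun n hn hpow => ?_⟩
      · exact absurd (h 1 2 one_pos two_pos (by simp [hs])) (by decide)
      · have := h 1 (n + 1) one_pos n.succ_pos (by rw [pow_succ _ n, hpow, one_mul, pow_one])
        omega
    · rintro (⟨h, -⟩ | ⟨-, hs, h⟩) m n - - hmn
      · exact absurd h hr1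
      · have ht : s / (r - 1) ≠ 0 := div_ne_zero hs hr'
        rcases lt_trichotomy m n with hlt | heq' | hlt
        · refine absurd ?_ (h (n - m) (by omega))
          rw [pow_sub₀ _ ht hlt.le, hmn, mul_inv_cancel₀ (pow_ne_zero _ ht)]
        · exact heq'
        · refine absurd ?_ (h (m - n) (by omega))
          rw [pow_sub₀ _ ht hlt.le, hmn, mul_inv_cancel₀ (pow_ne_zero _ ht)]
end

section
/- Let R be a field containing an element of infinite multiplicative order, and let x be an indeterminate over R. Then every polynomial ℓ' ∈ R[x] of degree 1 is 2-connected with x through degree-1 polynomials: there exists ℓ ∈ R[x] of degree 1 such that ℓ' ∼ ℓ and ℓ ∼ x. -/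
open Polynomial

/-- Two elements `a, b` of a commutative ring are 1-connected (`a ∼ b`) if for all
positive integers `m, n`, `a - b ∣ a^m - b^n` implies `m = n`. -/
def OneConnected {S : Type*} [CommRing S] (a b : S) : Prop :=
  ∀ m n : ℕ, 0 < m → 0 < n → (a - b) ∣ (a ^ m - b ^ n) → m = n

/-- Over a field, two polynomials taking a common nonzero value of infinite multiplicative order
at some point are 1-connected. -/
theorem oneConnected_of_eval_eq {R : Type*} [Field R] {p q : R[X]} {s t : R} (ht : t ≠ 0)
    (hord : ∀ n : ℕ, 1 ≤ n → t ^ n ≠ 1) (hp : p.eval s = t) (hq : q.eval s = t) :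
    OneConnected p q := by
  intro m n _ _ hdvd
  have h := eval_dvd (x := s) hdvd
  simp only [eval_sub, eval_pow, hp, hq, sub_self, zero_dvd_iff, sub_eq_zero] at h
  have hfin : ¬ IsOfFinOrder (Units.mk0 t ht) := by
    rw [isOfFinOrder_iff_pow_eq_one]
    rintro ⟨k, hk, hk1⟩
    exact hord k hk (by simpa using congrArg Units.val hk1)
  refine injective_pow_iff_not_isOfFinOrder.mpr hfin (Units.ext ?_)
  simpa using h

/-- If the field `R` has an element of infinite multiplicative order, then every degree-one
`ℓ' ∈ R[x]` is 2-connected with `x` through degree-one polynomials: there is a degree-one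
`ℓ` with `ℓ' ∼ ℓ` and `ℓ ∼ x`. -/
theorem stmt_12 {R : Type*} [Field R]
    (hR : ∃ a : R, a ≠ 0 ∧ ∀ n : ℕ, 1 ≤ n → a ^ n ≠ 1)
    (ℓ' : R[X]) (hℓ' : ℓ'.degree = 1) :
    ∃ ℓ : R[X], ℓ.degree = 1 ∧ OneConnected ℓ' ℓ ∧ OneConnected ℓ (X : R[X]) := by
  obtain ⟨u, hu0, hu⟩ := hR
  obtain ⟨a, b, ha, rfl⟩ : ∃ a b : R, a ≠ 0 ∧ ℓ' = C a * X + C b := by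
    refine ⟨ℓ'.coeff 1, ℓ'.coeff 0, ?_, eq_X_add_C_of_degree_le_one hℓ'.le⟩
    exact coeff_ne_zero_of_eq_degree hℓ'
  set s := (u - b) / a with hs
  obtain ⟨k, hk, hks⟩ : ∃ k : ℕ, 2 ≤ k ∧ s - u ^ k ≠ 0 := by
    by_contra! h
    have h23 : u ^ 2 * (u ^ 1 - 1) = 0 := by linear_combination h 2 le_rfl - h 3 (by norm_num)
    rcases mul_eq_zero.mp h23 with h0 | h1
    · exact pow_ne_zero 2 hu0 h0
    · exact hu 1 le_rfl (sub_eq_zero.mp h1)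
  have hku : u - u ^ k ≠ 0 := by
    intro h
    obtain ⟨j, rfl⟩ := Nat.exists_eq_add_of_le hk
    have hmul : u * (1 - u ^ (j + 1)) = 0 := by linear_combination h
    rcases mul_eq_zero.mp hmul with h0 | h1
    · exact hu0 h0
    · exact hu (j + 1) (by omega) (sub_eq_zero.mp h1).symm
  have hkord : ∀ n : ℕ, 1 ≤ n → (u ^ k) ^ n ≠ 1 := fun n hn => by
    rw [← pow_mul]
    exact hu _ (Nat.mul_pos (by omega) hn)
  set c := (u - u ^ k) / (s - u ^ k) with hc
  refine ⟨C c * X + C (u ^ k - c * u ^ k), degree_linear (div_ne_zero hku hks),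
    oneConnected_of_eval_eq (s := s) hu0 hu ?_ ?_,
    oneConnected_of_eval_eq (s := u ^ k) (pow_ne_zero k hu0) hkord ?_ eval_X⟩
  · simp only [eval_add, eval_mul, eval_C, eval_X, hs]
    field_simp
    ring
  · have hmul : c * (s - u ^ k) = u - u ^ k := div_mul_cancel₀ _ hks
    simp only [eval_add, eval_mul, eval_C, eval_X]
    linear_combination hmul
  · simp only [eval_add, eval_mul, eval_C, eval_X]
    ring
end

section
/- Let R be a field and x an indeterminate over R. If there exist polynomials l₀, l₁, l₂, l₃, l₄ ∈ R[x], all of degree 1, with l₀ = x, l₄ = x + 1, and l_{i−1} ∼ l_i for i = 1, 2, 3, 4, then R contains an element of infinite multiplicative order. -/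
open Polynomial

/-- Distinct 1-connected polynomials of degree one take a common value of infinite
multiplicative order at the root of their difference. -/
lemma OneConnected.exists_infinite_order {R : Type*} [Field R] {p q : R[X]}
    (hp : p.degree = 1) (hq : q.degree = 1) (hc : OneConnected p q) (hne : p ≠ q) :
    ∃ a : R, a ≠ 0 ∧ ∀ n : ℕ, 1 ≤ n → a ^ n ≠ 1 := by
  have hsub : p - q ≠ 0 := sub_ne_zero.mpr hne
  have hdeg : (p - q).degree = 1 := by
    have hle : (p - q).degree ≤ 1 := (degree_sub_le p q).trans (by simp [hp, hq])
    refine le_antisymm hle (not_lt.mp fun hlt => ?_)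
    have hunit : IsUnit (p - q) :=
      isUnit_iff_degree_eq_zero.mpr
        (le_antisymm (Order.le_of_lt_succ hlt) (zero_le_degree_iff.mpr hsub))
    exact absurd (hc 1 2 one_pos two_pos hunit.dvd) (by decide)
  obtain ⟨r, hr⟩ := exists_root_of_degree_eq_one hdeg
  have hpq : p.eval r = q.eval r := by simpa [IsRoot, sub_eq_zero] using hr
  have hassoc : p - q ∣ X - C r :=
    (associated_of_dvd_of_degree_eq (dvd_iff_isRoot.mpr hr)
      (by rw [degree_X_sub_C, hdeg])).symm.dvd
  have hinj : ∀ m n : ℕ, 0 < m → 0 < n → p.eval r ^ m = p.eval r ^ n → m = n := by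
    intro m n hm hn h
    refine hc m n hm hn (hassoc.trans (dvd_iff_isRoot.mpr ?_))
    simp [IsRoot, ← hpq, h]
  refine ⟨p.eval r, fun h0 => ?_, fun n hn h1 => ?_⟩
  · exact absurd (hinj 1 2 one_pos two_pos (by simp [h0])) (by decide)
  · have := hinj (n + 1) 1 n.succ_pos one_pos (by rw [pow_succ, h1, one_mul, pow_one])
    omega

/-- If there is a chain `x = l₀ ∼ l₁ ∼ l₂ ∼ l₃ ∼ l₄ = x + 1` of degree-one polynomials
in `R[x]`, then the field `R` contains an element of infinite multiplicative order. -/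
theorem stmt_14 {R : Type*} [Field R] (l₀ l₁ l₂ l₃ l₄ : R[X])
    (h₀ : l₀.degree = 1) (h₁ : l₁.degree = 1) (h₂ : l₂.degree = 1)
    (h₃ : l₃.degree = 1) (h₄ : l₄.degree = 1)
    (hx : l₀ = (X : R[X])) (hx1 : l₄ = (X : R[X]) + 1)
    (c₁ : OneConnected l₀ l₁) (c₂ : OneConnected l₁ l₂)
    (c₃ : OneConnected l₂ l₃) (c₄ : OneConnected l₃ l₄) :
    ∃ a : R, a ≠ 0 ∧ ∀ n : ℕ, 1 ≤ n → a ^ n ≠ 1 := by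
  by_cases e₁ : l₀ = l₁
  · by_cases e₂ : l₁ = l₂
    · by_cases e₃ : l₂ = l₃
      · refine c₄.exists_infinite_order h₃ h₄ fun e₄ => ?_
        have h : (X : R[X]) = X + 1 := by rw [← hx1, ← e₄, ← e₃, ← e₂, ← e₁, hx]
        simp at h
      · exact c₃.exists_infinite_order h₂ h₃ e₃
    · exact c₂.exists_infinite_order h₁ h₂ e₂
  · exact c₁.exists_infinite_order h₀ h₁ e₁
end
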